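/- Let η, ω > 0 with η·ω > 1, set α = 1/(1+η) and β = 1/(1+ω), and assume (α,β) belongs to the region A = {(α,β) ∈ (0,1)² : α+β < 1, and either α < 1 − β/(1−α−β) or β < 1 − α/(1−α−β)}. Let (a_n)_{n≥0} and (b_n)_{n≥0} be strictly increasing sequences of positive reals tending to infinity and C > 0 a constant such that for all n, k ≥ 1: |a_{k+n} − a_n| ≤ C k a_{k+n}^{−η}, |b_{k+n} − b_n| ≤ C k b_{k+n}^{−ω}, a_n ≤ C n^{1/(1+η)}, and b_n ≤ C n^{1/(1+ω)}. If f is a Schwartz function on ℝ with f(a_n) = f(−a_n) = 0 and f̂(b_n) = f̂(−b_n) = 0 for all n ≥ 0, then f is identically zero. -/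

import Mathlib

open MeasureTheory Filter

/-- The Fourier transform `f̂(ξ) = ∫_ℝ f(x) e^{2πi x ξ} dx`. -/
noncomputable def fourierTransform (f : ℝ → ℂ) (ξ : ℝ) : ℂ :=
  ∫ x : ℝ, f x * Complex.exp (2 * Real.pi * Complex.I * x * ξ)

/-- Generalized Rolle theorem: a smooth function with `k + 1` zeros has a `k`-th derivative
with a zero. -/
lemma exists_iteratedDeriv_eq_zero_of_zeros (k : ℕ) {g : ℝ → ℝ} (hg : ContDiff ℝ (⊤ : ℕ∞) g)
    {p : ℕ → ℝ} (hp : StrictMono p) (h : ∀ i ≤ k, g (p i) = 0) :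
    ∃ z, iteratedDeriv k g z = 0 := by
  induction k generalizing g p with
  | zero => exact ⟨p 0, by simpa using h 0 le_rfl⟩
  | succ k ih =>
    have hq : ∀ i, ∃ y ∈ Set.Ioo (p i) (p (i + 1)), i ≤ k → deriv g y = 0 := by
      intro i
      by_cases hi : i ≤ k
      · obtain ⟨y, hy, hy'⟩ := exists_deriv_eq_zero (hp (Nat.lt_succ_self i))
          hg.continuous.continuousOn ((h i (by omega)).trans (h (i + 1) (by omega)).symm)
        exact ⟨y, hy, fun _ => hy'⟩
      · obtain ⟨y, hy⟩ := exists_between (hp (Nat.lt_succ_self i))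
        exact ⟨y, hy, fun h => absurd h hi⟩
    choose q hq hq' using hq
    have hg' : ContDiff ℝ (⊤ : ℕ∞) (deriv g) := (contDiff_infty_iff_deriv.1 hg).2
    obtain ⟨z, hz⟩ := ih hg' (strictMono_nat_of_lt_succ fun i => (hq i).2.trans (hq (i + 1)).1) hq'
    exact ⟨z, by rw [iteratedDeriv_succ', hz]⟩

lemma iteratedDeriv_polynomial_eval (P : Polynomial ℝ) (k : ℕ) :
    iteratedDeriv k (fun t => P.eval t) = fun t => (Polynomial.derivative^[k] P).eval t := by
  induction k with
  | zero => simp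
  | succ k ih =>
    rw [iteratedDeriv_succ, ih]
    ext t
    rw [Polynomial.deriv, Function.iterate_succ_apply']

/-- Error bound for interpolation by zero at nodes to the right of `x`. -/
lemma abs_mul_factorial_le_of_zeros {k : ℕ} {g : ℝ → ℝ} (hg : ContDiff ℝ (⊤ : ℕ∞) g)
    {p : ℕ → ℝ} (hp : StrictMono p) (h : ∀ i < k, g (p i) = 0) {x : ℝ} (hx : x < p 0)
    {S : ℝ} (hS : ∀ t, |iteratedDeriv k g t| ≤ S) :
    |g x| * k.factorial ≤ S * ∏ i ∈ Finset.range k, (p i - x) := by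
  classical
  set s : Finset ℝ := (Finset.range k).image p
  have hs : s.card = k := by
    simp [s, Finset.card_image_of_injective _ hp.injective]
  set P : Polynomial ℝ := ∏ r ∈ s, (Polynomial.X - Polynomial.C r)
  have hPe : ∀ t, P.eval t = ∏ i ∈ Finset.range k, (t - p i) := by
    intro t
    simp [P, s, Polynomial.eval_prod, Finset.prod_image hp.injective.injOn]
  have hxp : ∀ i, x < p i := fun i => hx.trans_le (hp.monotone (Nat.zero_le i))
  have hPx : P.eval x ≠ 0 := by
    rw [hPe, Finset.prod_ne_zero_iff]
    exact fun i _ => sub_ne_zero.2 (hxp i).ne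
  have hPd : Polynomial.derivative^[k] P = Polynomial.C (k.factorial : ℝ) := by
    have := Polynomial.iterate_derivative_prod_X_sub_C (S := s) hs.ge
    simpa [hs, P] using this
  set c := g x / P.eval x
  have hPc : ContDiff ℝ (⊤ : ℕ∞) fun t => c * P.eval t := contDiff_const.mul
    (by simpa [Polynomial.coe_aeval_eq_eval] using P.contDiff_aeval (𝕜 := ℝ) (⊤ : ℕ∞))
  obtain ⟨z, hz⟩ := exists_iteratedDeriv_eq_zero_of_zeros k
    (g := g - fun t => c * P.eval t) (p := fun i => Nat.casesOn i x p) (hg.sub hPc)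
    (strictMono_nat_of_lt_succ fun i => by
      cases i with
      | zero => exact hx
      | succ i => exact hp (Nat.lt_succ_self i))
    (fun i hi => by
      cases i with
      | zero => simp [c, hPx]
      | succ i =>
        have : P.eval (p i) = 0 := by
          rw [hPe]
          exact Finset.prod_eq_zero (Finset.mem_range.2 hi) (sub_self _)
        simp [h i hi, this])
  rw [iteratedDeriv_sub (hg.contDiffAt.of_le (by exact_mod_cast le_top))
    (hPc.contDiffAt.of_le (by exact_mod_cast le_top)),
    iteratedDeriv_const_mul_field, iteratedDeriv_polynomial_eval, hPd, sub_eq_zero] at hz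
  have habs : |P.eval x| = ∏ i ∈ Finset.range k, (p i - x) := by
    rw [hPe, Finset.abs_prod]
    exact Finset.prod_congr rfl fun i _ => by
      rw [abs_sub_comm, abs_of_pos (sub_pos.2 (hxp i))]
  have hgx : |g x| = |c| * |P.eval x| := by
    rw [← abs_mul, div_mul_cancel₀ _ hPx]
  have h1 : |c| * k.factorial ≤ S := by
    have := hS z
    simp only [Polynomial.eval_C] at hz
    rw [hz, abs_mul, Nat.abs_cast] at this
    exact this
  rw [hgx, mul_right_comm, ← habs]
  gcongr

lemma norm_mul_factorial_le_of_zeros {k : ℕ} {f : ℝ → ℂ} (hf : ContDiff ℝ (⊤ : ℕ∞) f)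
    {p : ℕ → ℝ} (hp : StrictMono p) (h : ∀ i < k, f (p i) = 0) {x : ℝ} (hx : x < p 0)
    {S : ℝ} (hS : ∀ t, ‖iteratedDeriv k f t‖ ≤ S) :
    ‖f x‖ * k.factorial ≤ 2 * (S * ∏ i ∈ Finset.range k, (p i - x)) := by
  have key : ∀ L : ℂ →L[ℝ] ℝ, (∀ z, |L z| ≤ ‖z‖) →
      |L (f x)| * k.factorial ≤ S * ∏ i ∈ Finset.range k, (p i - x) := by
    intro L hL
    refine abs_mul_factorial_le_of_zeros (g := L ∘ f) (L.contDiff.comp hf) hp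
      (fun i hi => by simp [h i hi]) hx fun t => ?_
    have : iteratedDeriv k (L ∘ f) t = L (iteratedDeriv k f t) := by
      rw [iteratedDeriv, L.iteratedFDeriv_comp_left (n := (⊤ : ℕ∞)) hf.contDiffAt
        (by exact_mod_cast le_top)]
      rfl
    rw [this]
    exact (hL _).trans (hS t)
  have h1 := key Complex.reCLM Complex.abs_re_le_norm
  have h2 := key Complex.imCLM Complex.abs_im_le_norm
  have h3 : ‖f x‖ ≤ |Complex.reCLM (f x)| + |Complex.imCLM (f x)| :=
    Complex.norm_le_abs_re_add_abs_im _
  have h4 := mul_le_mul_of_nonneg_right h3 (Nat.cast_nonneg (α := ℝ) k.factorial)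
  linarith

lemma norm_le_of_zeros_of_pos {η C : ℝ} (hη : 0 < η) (hC : 0 < C) {a : ℕ → ℝ}
    (ha : StrictMono a) (hapos : ∀ n, 0 < a n) (hatop : Tendsto a atTop atTop)
    (hagap : ∀ n k : ℕ, 1 ≤ n → 1 ≤ k → |a (k + n) - a n| ≤ C * k * a (k + n) ^ (-η))
    {f : ℝ → ℂ} (hf : ContDiff ℝ (⊤ : ℕ∞) f) (hfa : ∀ n, f (a n) = 0) {k : ℕ} {S : ℝ}
    (hS : ∀ t, ‖iteratedDeriv k f t‖ ≤ S) {x : ℝ} (hx : a 1 ≤ x) :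
    ‖f x‖ ≤ 2 * ((C * x ^ (-η)) ^ k * S) := by
  classical
  have hx0 : 0 < x := (hapos 1).trans_le hx
  have hS0 : 0 ≤ S := (norm_nonneg _).trans (hS 0)
  have hex : ∃ N, x < a N := (hatop.eventually_gt_atTop x).exists
  obtain ⟨N, hN, hmin⟩ : ∃ N, x < a N ∧ ∀ m < N, a m ≤ x :=
    ⟨Nat.find hex, Nat.find_spec hex, fun m hm => not_lt.1 (Nat.find_min hex hm)⟩
  have hN2 : 1 < N := ha.lt_iff_lt.1 (hx.trans_lt hN)
  obtain ⟨n, rfl⟩ : ∃ n, N = n + 1 := ⟨N - 1, by omega⟩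
  have hn : a n ≤ x := hmin n (Nat.lt_succ_self n)
  have hgt : ∀ i, x < a (i + (n + 1)) := fun i => hN.trans_le (ha.monotone (by omega))
  have hmain := norm_mul_factorial_le_of_zeros hf (p := fun i => a (i + (n + 1)))
    (fun i j hij => ha (by omega)) (fun i _ => hfa _) (x := x) (hgt 0) hS
  have hprod : ∏ i ∈ Finset.range k, (a (i + (n + 1)) - x) ≤
      (C * x ^ (-η)) ^ k * k.factorial := by
    calc _ ≤ ∏ i ∈ Finset.range k, (C * x ^ (-η) * ((i + 1 : ℕ) : ℝ)) := by
          refine Finset.prod_le_prod (fun i _ => (sub_pos.2 (hgt i)).le) fun i _ => ?_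
          have h1 := hagap n (i + 1) (by omega) (by omega)
          rw [show i + 1 + n = i + (n + 1) by ring] at h1
          have h2 : a (i + (n + 1)) ^ (-η) ≤ x ^ (-η) :=
            Real.rpow_le_rpow_of_nonpos hx0 (hgt i).le (by linarith)
          calc a (i + (n + 1)) - x ≤ |a (i + (n + 1)) - a n| :=
                (by linarith : _ ≤ a (i + (n + 1)) - a n).trans (le_abs_self _)
            _ ≤ C * ((i + 1 : ℕ) : ℝ) * x ^ (-η) := h1.trans (by gcongr)
            _ = _ := by ring
      _ = _ := by
          rw [Finset.prod_mul_distrib, Finset.prod_const, Finset.card_range, ← Nat.cast_prod,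
            Finset.prod_range_add_one_eq_factorial]
  have hk : (0 : ℝ) < k.factorial := by positivity
  refine le_of_mul_le_mul_right (hmain.trans ?_) hk
  calc _ ≤ 2 * (S * ((C * x ^ (-η)) ^ k * k.factorial)) := by gcongr
    _ = _ := by ring

lemma norm_le_of_zeros {η C : ℝ} (hη : 0 < η) (hC : 0 < C) {a : ℕ → ℝ}
    (ha : StrictMono a) (hapos : ∀ n, 0 < a n) (hatop : Tendsto a atTop atTop)
    (hagap : ∀ n k : ℕ, 1 ≤ n → 1 ≤ k → |a (k + n) - a n| ≤ C * k * a (k + n) ^ (-η))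
    {f : ℝ → ℂ} (hf : ContDiff ℝ (⊤ : ℕ∞) f) (hfa : ∀ n, f (a n) = 0 ∧ f (-(a n)) = 0)
    {k : ℕ} {S : ℝ} (hS : ∀ t, ‖iteratedDeriv k f t‖ ≤ S) {x : ℝ} (hx : a 1 ≤ |x|) :
    ‖f x‖ ≤ 2 * ((C * |x| ^ (-η)) ^ k * S) := by
  rcases le_total 0 x with h0 | h0
  · rw [abs_of_nonneg h0] at hx ⊢
    exact norm_le_of_zeros_of_pos hη hC ha hapos hatop hagap hf (fun n => (hfa n).1) hS hx
  · rw [abs_of_nonpos h0] at hx ⊢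
    have := norm_le_of_zeros_of_pos hη hC ha hapos hatop hagap (f := fun t => f (-t))
      (hf.comp contDiff_neg) (fun n => (hfa n).2) (k := k) (S := S) (fun t => by
        rw [iteratedDeriv_comp_neg, norm_smul]
        simpa using hS (-t)) hx
    simpa using this

/-- The absolute moments of a Schwartz function. -/
noncomputable def absMoment (f : SchwartzMap ℝ ℂ) (m : ℕ) : ℝ := ∫ x : ℝ, |x| ^ m * ‖f x‖

lemma absMoment_nonneg (f : SchwartzMap ℝ ℂ) (m : ℕ) : 0 ≤ absMoment f m :=
  integral_nonneg fun x => by positivity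

lemma absMoment_le_of_decay {η C x₀ S : ℝ} (hC : 0 < C) (hx₀ : 1 ≤ x₀)
    (f : SchwartzMap ℝ ℂ) {k m : ℕ} (hS : 0 ≤ S)
    (hdecay : ∀ x, x₀ ≤ |x| → ‖f x‖ ≤ 2 * ((C * |x| ^ (-η)) ^ k * S))
    (hmk : (m : ℝ) + 2 ≤ η * k) :
    absMoment f m ≤ x₀ ^ m * absMoment f 0 + 4 * Real.pi * (C ^ k * S) := by
  have hint : ∀ j : ℕ, Integrable fun x : ℝ => |x| ^ j * ‖f x‖ := fun j => by
    simpa using f.integrable_pow_mul volume j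
  have hpt : ∀ x : ℝ, |x| ^ m * ‖f x‖ ≤
      x₀ ^ m * (|x| ^ 0 * ‖f x‖) + 4 * (C ^ k * S) * (1 + x ^ 2)⁻¹ := by
    intro x
    rcases le_total |x| x₀ with h | h
    · have : |x| ^ m * ‖f x‖ ≤ x₀ ^ m * ‖f x‖ := by gcongr
      have h2 : 0 ≤ 4 * (C ^ k * S) * (1 + x ^ 2)⁻¹ := by positivity
      simpa using this.trans (le_add_of_nonneg_right h2)
    · have h1 : 1 ≤ |x| := hx₀.trans h
      have h0 : 0 < |x| := by linarith
      have hpow : |x| ^ m * (|x| ^ (-η)) ^ k ≤ 2 * (1 + x ^ 2)⁻¹ := by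
        calc |x| ^ m * (|x| ^ (-η)) ^ k = |x| ^ ((m : ℝ) + -η * k) := by
              rw [Real.rpow_add h0, Real.rpow_natCast, Real.rpow_mul h0.le, Real.rpow_natCast]
          _ ≤ |x| ^ (-2 : ℝ) := Real.rpow_le_rpow_of_exponent_le h1 (by linarith)
          _ = (x ^ 2)⁻¹ := by
              rw [Real.rpow_neg h0.le]
              norm_cast
              rw [sq_abs]
          _ ≤ 2 * (1 + x ^ 2)⁻¹ := by
              have hx2 : 1 ≤ x ^ 2 := by
                rw [← sq_abs]
                nlinarith
              rw [← div_eq_mul_inv, inv_le_comm₀ (by positivity) (by positivity), inv_div]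
              linarith
      have h3 : 0 ≤ x₀ ^ m * (|x| ^ 0 * ‖f x‖) := by positivity
      calc |x| ^ m * ‖f x‖ ≤ |x| ^ m * (2 * ((C * |x| ^ (-η)) ^ k * S)) := by
            gcongr
            exact hdecay x h
        _ = 2 * (C ^ k * S) * (|x| ^ m * (|x| ^ (-η)) ^ k) := by
            rw [mul_pow]
            ring
        _ ≤ 2 * (C ^ k * S) * (2 * (1 + x ^ 2)⁻¹) := by gcongr
        _ ≤ _ := by linarith
  have hi1 := (hint 0).const_mul (x₀ ^ m)
  have hi2 := integrable_inv_one_add_sq.const_mul (4 * (C ^ k * S))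
  calc absMoment f m ≤ ∫ x : ℝ, (x₀ ^ m * (|x| ^ 0 * ‖f x‖) +
        4 * (C ^ k * S) * (1 + x ^ 2)⁻¹) := integral_mono (hint m) (hi1.add hi2) hpt
    _ = _ := by
      rw [integral_add hi1 hi2, integral_const_mul, integral_const_mul,
        integral_univ_inv_one_add_sq, absMoment]
      ring

lemma exists_exponents {η ω : ℝ} (hη : 0 < η) (hω : 0 < ω) (hηω : 1 < η * ω) :
    ∃ L q m₀ : ℕ, ∀ m : ℕ, ∃ k j : ℕ, (m : ℝ) + 2 ≤ η * k ∧ (k : ℝ) + 2 ≤ ω * j ∧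
      k ≤ L * (m + 1) ∧ j ≤ L * (m + 1) ∧ (m₀ ≤ m → j < m ∧ q * j + m + 2 ≤ q * m) := by
  set θ := 1 / (η * ω) with hθ
  have hθ1 : θ < 1 := (div_lt_one (by positivity)).2 hηω
  have hθ0 : 0 < θ := by positivity
  set c := 2 * θ + 3 / ω + 1 with hc
  have hc0 : 0 < c := by positivity
  set q := ⌈2 / (1 - θ)⌉₊ with hq
  refine ⟨⌈2 / η + 1 + (θ + c)⌉₊, q, ⌈2 + q * c⌉₊, fun m => ?_⟩
  have hL := Nat.le_ceil (2 / η + 1 + (θ + c))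
  set L := ⌈2 / η + 1 + (θ + c)⌉₊
  have hqθ : 2 ≤ q * (1 - θ) := (div_le_iff₀ (by linarith)).1 (Nat.le_ceil _)
  have hm0 : (0 : ℝ) ≤ m := Nat.cast_nonneg m
  set k := ⌈((m : ℝ) + 2) / η⌉₊
  have hk1 : ((m : ℝ) + 2) / η ≤ k := Nat.le_ceil _
  have hk2 : (k : ℝ) < ((m : ℝ) + 2) / η + 1 := Nat.ceil_lt_add_one (by positivity)
  set j := ⌈((k : ℝ) + 2) / ω⌉₊
  have hj1 : ((k : ℝ) + 2) / ω ≤ j := Nat.le_ceil _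
  have hj2 : (j : ℝ) < ((k : ℝ) + 2) / ω + 1 := Nat.ceil_lt_add_one (by positivity)
  have hj3 : (j : ℝ) ≤ θ * m + c := by
    have h1 : ((k : ℝ) + 2) / ω ≤ (((m : ℝ) + 2) / η + 1 + 2) / ω := by gcongr
    have h2 : (((m : ℝ) + 2) / η + 1 + 2) / ω + 1 = θ * m + c := by
      rw [hc, hθ]
      field_simp
      ring
    linarith
  have hη' : 0 < 1 / η := by positivity
  refine ⟨k, j, ?_, ?_, ?_, ?_, fun hm => ?_⟩
  · rwa [div_le_iff₀' hη] at hk1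
  · rwa [div_le_iff₀' hω] at hj1
  · have h1 : ((m : ℝ) + 2) / η + 1 ≤ (2 / η + 1) * (m + 1) := by
      have : (2 / η + 1) * (m + 1) - (((m : ℝ) + 2) / η + 1) = 1 / η * m + m := by
        field_simp
        ring
      nlinarith
    have h2 : (2 / η + 1) * ((m : ℝ) + 1) ≤ L * (m + 1) := by
      gcongr
      linarith
    have : (k : ℝ) ≤ L * (m + 1) := by linarith
    exact_mod_cast this
  · have h1 : (θ + c) * ((m : ℝ) + 1) ≤ L * (m + 1) := by
      gcongr
      have : 0 < 2 / η := by positivity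
      linarith
    have : (j : ℝ) ≤ L * (m + 1) := by nlinarith
    exact_mod_cast this
  · have hm' : 2 + q * c ≤ m := (Nat.le_ceil _).trans (by exact_mod_cast hm)
    have h1 : (q : ℝ) * j ≤ q * (θ * m + c) := by gcongr
    have h2 : (q : ℝ) * j + m + 2 ≤ q * m := by nlinarith
    have h3 : q * j + m + 2 ≤ q * m := by exact_mod_cast h2
    exact ⟨lt_of_mul_lt_mul_left (by omega : q * j < q * m) (Nat.zero_le q), h3⟩

/-- Two sequences of moments controlling each other with a total contraction of the index grow at
most geometrically. -/
lemma exists_geometric_bound {η ω : ℝ} (hη : 0 < η) (hω : 0 < ω) (hηω : 1 < η * ω)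
    {M N : ℕ → ℝ} {B B' : ℝ}
    (hM : ∀ m k : ℕ, (m : ℝ) + 2 ≤ η * k → M m ≤ B ^ (m + 1) + B ^ (k + 1) * N k)
    (hN : ∀ m k : ℕ, (m : ℝ) + 2 ≤ ω * k → N m ≤ B' ^ (m + 1) + B' ^ (k + 1) * M k)
    (hM0 : ∀ m, 0 ≤ M m) (hB : 1 ≤ B) (hB' : 1 ≤ B') :
    ∃ K : ℝ, 1 ≤ K ∧ ∀ m, M m ≤ K ^ (m + 1) := by
  obtain ⟨L, q, m₀, hE⟩ := exists_exponents hη hω hηω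
  set A := max 2 (max B B') with hA
  have hA2 : 2 ≤ A := le_max_left _ _
  have hA1 : 1 ≤ A := by linarith
  have hBA : B ≤ A := (le_max_left _ _).trans (le_max_right _ _)
  have hBA' : B' ≤ A := (le_max_right _ _).trans (le_max_right _ _)
  set D := A ^ (2 * L + 3) with hD
  have hD2 : 2 ≤ D := hA2.trans (le_self_pow₀ hA1 (by omega))
  have hD1 : 1 ≤ D := by linarith
  have hstep : ∀ m k j : ℕ, (m : ℝ) + 2 ≤ η * k → (k : ℝ) + 2 ≤ ω * j →
      k ≤ L * (m + 1) → j ≤ L * (m + 1) → M m ≤ D ^ (m + 1) * (1 + M j) := by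
    intro m k j h1 h2 h3 h4
    have e1 : B ^ (m + 1) ≤ A ^ (m + 1) := by gcongr
    have e2 : B ^ (k + 1) ≤ A ^ (L * (m + 1) + 1) :=
      (pow_le_pow_left₀ (by linarith) hBA _).trans (pow_le_pow_right₀ hA1 (by omega))
    have e3 : B' ^ (k + 1) ≤ A ^ (L * (m + 1) + 1) :=
      (pow_le_pow_left₀ (by linarith) hBA' _).trans (pow_le_pow_right₀ hA1 (by omega))
    have e4 : B' ^ (j + 1) ≤ A ^ (L * (m + 1) + 1) :=
      (pow_le_pow_left₀ (by linarith) hBA' _).trans (pow_le_pow_right₀ hA1 (by omega))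
    have hMj := hM0 j
    have hNk : N k ≤ A ^ (L * (m + 1) + 1) * (1 + M j) := by
      calc N k ≤ B' ^ (k + 1) + B' ^ (j + 1) * M j := hN k j h2
        _ ≤ A ^ (L * (m + 1) + 1) + A ^ (L * (m + 1) + 1) * M j := by gcongr
        _ = _ := by ring
    have hlow : A ^ (m + 1) ≤ A ^ (L * (m + 1) + 1 + (L * (m + 1) + 1) + m) :=
      pow_le_pow_right₀ hA1 (by omega)
    calc M m ≤ B ^ (m + 1) + B ^ (k + 1) * N k := hM m k h1
      _ ≤ A ^ (m + 1) + A ^ (L * (m + 1) + 1) * (A ^ (L * (m + 1) + 1) * (1 + M j)) := by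
          have : 0 ≤ A ^ (L * (m + 1) + 1) * (1 + M j) := by positivity
          have : B ^ (k + 1) * N k ≤ B ^ (k + 1) * (A ^ (L * (m + 1) + 1) * (1 + M j)) := by
            gcongr
          have : B ^ (k + 1) * (A ^ (L * (m + 1) + 1) * (1 + M j)) ≤
              A ^ (L * (m + 1) + 1) * (A ^ (L * (m + 1) + 1) * (1 + M j)) := by gcongr
          linarith
      _ = A ^ (m + 1) * 1 + A ^ (L * (m + 1) + 1 + (L * (m + 1) + 1)) * (1 + M j) := by ring
      _ ≤ A ^ (L * (m + 1) + 1 + (L * (m + 1) + 1) + m) * (1 + M j) +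
          A ^ (L * (m + 1) + 1 + (L * (m + 1) + 1) + m) * (1 + M j) := by
          refine add_le_add (mul_le_mul hlow (by linarith) zero_le_one (by positivity)) ?_
          exact mul_le_mul_of_nonneg_right (pow_le_pow_right₀ hA1 (by omega)) (by linarith)
      _ = 2 * A ^ (L * (m + 1) + 1 + (L * (m + 1) + 1) + m) * (1 + M j) := by ring
      _ ≤ A * A ^ (L * (m + 1) + 1 + (L * (m + 1) + 1) + m) * (1 + M j) := by gcongr
      _ ≤ D ^ (m + 1) * (1 + M j) := by
          rw [← pow_succ', hD, ← pow_mul]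
          exact mul_le_mul_of_nonneg_right (pow_le_pow_right₀ hA1 (by nlinarith)) (by linarith)
  set T := 1 + ∑ i ∈ Finset.range m₀, M i with hT
  have hT1 : 1 ≤ T := le_add_of_nonneg_right (Finset.sum_nonneg fun i _ => hM0 i)
  set K := max (D ^ q) T
  have hK1 : 1 ≤ K := hT1.trans (le_max_right _ _)
  refine ⟨K, hK1, fun m => ?_⟩
  induction m using Nat.strong_induction_on with
  | _ m ih =>
    by_cases hm : m < m₀
    · have h1 : M m ≤ ∑ i ∈ Finset.range m₀, M i :=
        Finset.single_le_sum (f := M) (fun i _ => hM0 i) (Finset.mem_range.2 hm)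
      calc M m ≤ T := by linarith
        _ ≤ K := le_max_right _ _
        _ ≤ K ^ (m + 1) := le_self_pow₀ hK1 (by omega)
    · obtain ⟨k, j, h1, h2, h3, h4, h5⟩ := hE m
      obtain ⟨hjm, hq⟩ := h5 (not_lt.1 hm)
      have hKj : 1 ≤ K ^ (j + 1) := one_le_pow₀ hK1
      have hKD : D ^ (m + 2) ≤ K ^ (m - j) := by
        calc D ^ (m + 2) ≤ D ^ (q * (m - j)) := by
              refine pow_le_pow_right₀ hD1 ?_
              rw [Nat.mul_sub]
              omega
          _ = (D ^ q) ^ (m - j) := pow_mul _ _ _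
          _ ≤ K ^ (m - j) := by
              gcongr
              exact le_max_left _ _
      calc M m ≤ D ^ (m + 1) * (1 + M j) := hstep m k j h1 h2 h3 h4
        _ ≤ D ^ (m + 1) * (K ^ (j + 1) + K ^ (j + 1)) := by
            gcongr
            exact ih j hjm
        _ = 2 * D ^ (m + 1) * K ^ (j + 1) := by ring
        _ ≤ D * D ^ (m + 1) * K ^ (j + 1) := by gcongr
        _ = D ^ (m + 2) * K ^ (j + 1) := by ring
        _ ≤ K ^ (m - j) * K ^ (j + 1) := by gcongr
        _ = K ^ (m + 1) := by
            rw [← pow_add]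
            congr 1
            omega

open scoped FourierTransform in
lemma norm_iteratedDeriv_fourier_le (f : SchwartzMap ℝ ℂ) (k : ℕ) (x : ℝ) :
    ‖iteratedDeriv k (𝓕 f : SchwartzMap ℝ ℂ) x‖ ≤ (2 * Real.pi) ^ k * absMoment f k := by
  have hint : ∀ n : ℕ, Integrable fun x : ℝ => x ^ n • f x := fun n => by
    refine (integrable_norm_iff ?_).1 ?_
    · exact ((continuous_pow n).smul f.continuous).aestronglyMeasurable
    · simpa [norm_smul] using f.integrable_pow_mul volume n
  rw [SchwartzMap.fourier_coe, Real.iteratedDeriv_fourier (N := ⊤) (fun n _ => hint n) le_top]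
  refine (VectorFourier.norm_fourierIntegral_le_integral_norm _ _ _ _ _).trans_eq ?_
  rw [absMoment, ← integral_const_mul]
  refine integral_congr_ae (Eventually.of_forall fun t => ?_)
  simp [mul_pow, abs_of_pos Real.pi_pos, mul_assoc]

open scoped FourierTransform in
lemma fourier_fourier_apply (f : SchwartzMap ℝ ℂ) (x : ℝ) :
    (𝓕 (𝓕 f) : SchwartzMap ℝ ℂ) x = f (-x) := by
  have h : (𝓕⁻ (𝓕 f) : SchwartzMap ℝ ℂ) (-x) = f (-x) := by simp
  rw [← h, SchwartzMap.fourierInv_coe, Real.fourierInv_eq_fourier_neg, neg_neg,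
    SchwartzMap.fourier_coe (𝓕 f)]

open scoped FourierTransform in
lemma norm_iteratedDeriv_le (f : SchwartzMap ℝ ℂ) (k : ℕ) (x : ℝ) :
    ‖iteratedDeriv k f x‖ ≤ (2 * Real.pi) ^ k * absMoment (𝓕 f : SchwartzMap ℝ ℂ) k := by
  have h : (f : ℝ → ℂ) = fun t => (𝓕 (𝓕 f) : SchwartzMap ℝ ℂ) (-t) := by
    ext t
    rw [fourier_fourier_apply, neg_neg]
  rw [h, iteratedDeriv_comp_neg, norm_smul]
  simpa using norm_iteratedDeriv_fourier_le (𝓕 f) k (-x)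

open scoped FourierTransform in
lemma fourierTransform_eq_fourier_neg (f : SchwartzMap ℝ ℂ) (ξ : ℝ) :
    fourierTransform f ξ = (𝓕 f : SchwartzMap ℝ ℂ) (-ξ) := by
  rw [SchwartzMap.fourier_coe, Real.fourier_eq', fourierTransform]
  refine integral_congr_ae (Eventually.of_forall fun t => ?_)
  simp only [smul_eq_mul]
  rw [mul_comm]
  congr 2
  simp
  ring

lemma exists_absMoment_le {η C : ℝ} (hη : 0 < η) (hC : 0 < C) {a : ℕ → ℝ}
    (ha : StrictMono a) (hapos : ∀ n, 0 < a n) (hatop : Tendsto a atTop atTop)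
    (hagap : ∀ n k : ℕ, 1 ≤ n → 1 ≤ k → |a (k + n) - a n| ≤ C * k * a (k + n) ^ (-η))
    {f g : SchwartzMap ℝ ℂ} (hfa : ∀ n, f (a n) = 0 ∧ f (-(a n)) = 0)
    (hfg : ∀ k x, ‖iteratedDeriv k f x‖ ≤ (2 * Real.pi) ^ k * absMoment g k) :
    ∃ B : ℝ, 1 ≤ B ∧ ∀ m k : ℕ, (m : ℝ) + 2 ≤ η * k →
      absMoment f m ≤ B ^ (m + 1) + B ^ (k + 1) * absMoment g k := by
  set x₀ := max 1 (a 1)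
  have hx₀ : 1 ≤ x₀ := le_max_left _ _
  have hM0 := absMoment_nonneg f 0
  have hpi := Real.pi_pos
  have hCpi : 0 < 2 * Real.pi * C := by positivity
  set B := x₀ + absMoment f 0 + 4 * Real.pi + 2 * Real.pi * C with hB
  refine ⟨B, by linarith, fun m k hmk => ?_⟩
  have hMg := absMoment_nonneg g k
  have h := absMoment_le_of_decay (η := η) (C := C) hC hx₀ f (k := k) (m := m)
    (S := (2 * Real.pi) ^ k * absMoment g k) (by positivity)
    (fun x hx => norm_le_of_zeros hη hC ha hapos hatop hagap (f.smooth _) hfa (hfg k)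
      ((le_max_right _ _).trans hx)) hmk
  have h1 : x₀ ^ m * absMoment f 0 ≤ B ^ m * B := by
    have : x₀ ≤ B := by linarith
    have : absMoment f 0 ≤ B := by linarith
    gcongr
  have h2 : (2 * Real.pi * C) ^ k * (4 * Real.pi) ≤ B ^ k * B := by
    have : 2 * Real.pi * C ≤ B := by linarith
    have : 4 * Real.pi ≤ B := by linarith
    have : 0 ≤ B := by linarith
    gcongr
  calc absMoment f m ≤ _ := h
    _ = x₀ ^ m * absMoment f 0 + (2 * Real.pi * C) ^ k * (4 * Real.pi) * absMoment g k := by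
        rw [mul_pow (2 * Real.pi) C]
        ring
    _ ≤ _ := by
        rw [pow_succ, pow_succ]
        gcongr

/-- A smooth function vanishing on a right half-line whose derivatives grow at most geometrically
is zero. -/
lemma eq_zero_of_eventually_zero {f : ℝ → ℂ} (hf : ContDiff ℝ (⊤ : ℕ∞) f) {X A P : ℝ}
    (hP : 0 ≤ P) (hX : ∀ x, X ≤ x → f x = 0)
    (hD : ∀ (k : ℕ) x, ‖iteratedDeriv k f x‖ ≤ P ^ k * A) (x : ℝ) : f x = 0 := by
  rcases le_or_gt X x with h | h
  · exact hX x h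
  have hA : 0 ≤ A := (norm_nonneg _).trans (by simpa using hD 0 0)
  set R := P * (X + 1 - x)
  have hbd : ∀ k : ℕ, ‖f x‖ ≤ 2 * A * (R ^ k / k.factorial) := by
    intro k
    have hp : StrictMono fun i : ℕ => X + 1 - 1 / ((i : ℝ) + 1) := by
      refine strictMono_nat_of_lt_succ fun i => ?_
      have : 1 / (((i + 1 : ℕ) : ℝ) + 1) < 1 / ((i : ℝ) + 1) :=
        one_div_lt_one_div_of_lt (by positivity) (by push_cast; linarith)
      linarith
    have hle : ∀ i : ℕ, 1 / ((i : ℝ) + 1) ≤ 1 := fun i =>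
      (div_le_one (by positivity)).2 (by linarith [Nat.cast_nonneg (α := ℝ) i])
    have h1 := norm_mul_factorial_le_of_zeros hf hp (k := k)
      (fun i _ => hX _ (by linarith [hle i])) (x := x) (by simpa using h) (hD k)
    have h2 : ∏ i ∈ Finset.range k, (X + 1 - 1 / ((i : ℝ) + 1) - x) ≤ (X + 1 - x) ^ k := by
      calc _ ≤ ∏ _i ∈ Finset.range k, (X + 1 - x) := by
            refine Finset.prod_le_prod (fun i _ => ?_) fun i _ => ?_
            · linarith [hle i]
            · have : 0 < 1 / ((i : ℝ) + 1) := by positivity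
              linarith
        _ = _ := by simp
    rw [mul_div_assoc', le_div_iff₀ (by positivity)]
    calc _ ≤ _ := h1
      _ ≤ 2 * (P ^ k * A * (X + 1 - x) ^ k) := by gcongr
      _ = _ := by
        rw [mul_pow]
        ring
  have hlim := (FloorSemiring.tendsto_pow_div_factorial_atTop R).const_mul (2 * A)
  rw [mul_zero] at hlim
  exact norm_le_zero_iff.1 (ge_of_tendsto' hlim hbd)

theorem uniqueness_general_sequences (η ω : ℝ) (hη : 0 < η) (hω : 0 < ω)
    (hηω : 1 < η * ω)
    (α β : ℝ) (hα : α = 1 / (1 + η)) (hβ : β = 1 / (1 + ω))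
    (hα' : α ∈ Set.Ioo (0 : ℝ) 1) (hβ' : β ∈ Set.Ioo (0 : ℝ) 1)
    (hsum : α + β < 1)
    (hregion : α < 1 - β / (1 - α - β) ∨ β < 1 - α / (1 - α - β))
    (a b : ℕ → ℝ) (ha : StrictMono a) (hb : StrictMono b)
    (hapos : ∀ n : ℕ, 0 < a n) (hbpos : ∀ n : ℕ, 0 < b n)
    (hatop : Tendsto a atTop atTop) (hbtop : Tendsto b atTop atTop)
    (C : ℝ) (hC : 0 < C)
    (hagap : ∀ n k : ℕ, 1 ≤ n → 1 ≤ k → |a (k + n) - a n| ≤ C * k * a (k + n) ^ (-η))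
    (hbgap : ∀ n k : ℕ, 1 ≤ n → 1 ≤ k → |b (k + n) - b n| ≤ C * k * b (k + n) ^ (-ω))
    (hagrowth : ∀ n : ℕ, 1 ≤ n → a n ≤ C * (n : ℝ) ^ (1 / (1 + η)))
    (hbgrowth : ∀ n : ℕ, 1 ≤ n → b n ≤ C * (n : ℝ) ^ (1 / (1 + ω)))
    (f : SchwartzMap ℝ ℂ)
    (hf : ∀ n : ℕ, f (a n) = 0 ∧ f (-(a n)) = 0)
    (hfhat : ∀ n : ℕ, fourierTransform f (b n) = 0 ∧ fourierTransform f (-(b n)) = 0) :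
    ∀ x : ℝ, f x = 0 := by
  set g : SchwartzMap ℝ ℂ := FourierTransform.fourier f
  have hga : ∀ n, g (b n) = 0 ∧ g (-(b n)) = 0 := fun n => by
    have h1 := (hfhat n).1
    have h2 := (hfhat n).2
    rw [fourierTransform_eq_fourier_neg] at h1 h2
    rw [neg_neg] at h2
    exact ⟨h2, h1⟩
  obtain ⟨B, hB, hM⟩ := exists_absMoment_le hη hC ha hapos hatop hagap hf
    (norm_iteratedDeriv_le f)
  obtain ⟨B', hB', hN⟩ := exists_absMoment_le hω hC hb hbpos hbtop hbgap hga
    (norm_iteratedDeriv_fourier_le f)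
  obtain ⟨K, hK, hgK⟩ := exists_geometric_bound hω hη (by rwa [mul_comm]) hN hM
    (absMoment_nonneg g) hB' hB
  have hK0 : 0 < K := by linarith
  have hpi := Real.pi_pos
  have hD : ∀ (k : ℕ) x, ‖iteratedDeriv k f x‖ ≤ (2 * Real.pi * K) ^ k * K := fun k x =>
    calc _ ≤ (2 * Real.pi) ^ k * absMoment g k := norm_iteratedDeriv_le f k x
      _ ≤ (2 * Real.pi) ^ k * K ^ (k + 1) := by
          gcongr
          exact hgK k
      _ = _ := by ring
  have hev : ∀ᶠ x : ℝ in atTop, 2 * Real.pi * K * C * x ^ (-η) < 1 := by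
    have := (tendsto_rpow_neg_atTop hη).const_mul (2 * Real.pi * K * C)
    rw [mul_zero] at this
    exact this.eventually_lt_const one_pos
  obtain ⟨X, hX⟩ := eventually_atTop.1 (hev.and (eventually_ge_atTop (a 1)))
  refine eq_zero_of_eventually_zero (f.smooth _) (X := X) (by positivity) (fun x hx => ?_) hD
  obtain ⟨hx1, hx2⟩ := hX x hx
  have hx0 : 0 < x := (hapos 1).trans_le hx2
  have hbd : ∀ k : ℕ, ‖f x‖ ≤ 2 * K * (2 * Real.pi * K * C * x ^ (-η)) ^ k := fun k =>
    calc _ ≤ _ := norm_le_of_zeros_of_pos hη hC ha hapos hatop hagap (f.smooth _)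
          (fun n => (hf n).1) (hD k) hx2
      _ = 2 * K * ((2 * Real.pi * K) * (C * x ^ (-η))) ^ k := by
          rw [mul_pow (2 * Real.pi * K)]
          ring
      _ = _ := by rw [mul_assoc (2 * Real.pi * K)]
  have hlim := (tendsto_pow_atTop_nhds_zero_of_lt_one (by positivity) hx1).const_mul (2 * K)
  rw [mul_zero] at hlim
  exact norm_le_zero_iff.1 (ge_of_tendsto' hlim hbd)
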